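/- Suppose (m_{j_k})_{k≥1} is a subsequence of (m_j)_{j≥1} with j_1 > 1 and m_j/m_{j-1} > 2^{k+2} for all j ≥ j_k. Then for every η = (η_k)_{k≥1} ∈ {0,1}^{ℕ*}, the number θ(η) = Σ_{k=1}^{∞} η_k/m_{j_k} satisfies: for every j ≥ 1, ‖m_j θ(η)‖ ≤ 2 m_j/m_{j_k}, where k is the smallest integer with j_k > j; moreover Σ_{j=1}^{∞} ‖m_j θ(η)‖² < ∞ and L(θ(η)) > 0, where L(θ) = lim_{k→∞} ∏_{j=1}^{k-1} (1 + 2cos(2π m_j θ))/3. -/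

import Mathlib

/-- distance from a real number to the nearest integer -/
noncomputable def nint (t : ℝ) : ℝ := |t - round t|

/-- The distance to the nearest integer is at most the distance to any integer. -/
lemma nint_le_abs_sub (t : ℝ) (z : ℤ) : nint t ≤ |t - z| := round_le t z

lemma nint_nonneg (t : ℝ) : 0 ≤ nint t := abs_nonneg _

/-- A lacunary sequence with ratio at least `3` grows at least like `3 ^ n`. -/
lemma three_pow_mul_le_of_lacunary {u : ℕ → ℕ} (hu : ∀ i, 3 * u i ≤ u (i + 1)) (i n : ℕ) :
    3 ^ n * u i ≤ u (i + n) := by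
  induction n with
  | zero => simp
  | succ n ih =>
    calc 3 ^ (n + 1) * u i = 3 * (3 ^ n * u i) := by ring
      _ ≤ 3 * u (i + n) := by gcongr
      _ ≤ u (i + (n + 1)) := hu (i + n)

lemma dvd_of_dvd_succ {u : ℕ → ℕ} (hu : ∀ i, u i ∣ u (i + 1)) {i j : ℕ} (hij : i ≤ j) :
    u i ∣ u j := by
  induction j, hij using Nat.le_induction with
  | base => exact dvd_rfl
  | succ j _ ih => exact ih.trans (hu j)

section Lacunary

variable {M η : ℕ → ℕ}

lemma digit_div_le_geometric (hM : ∀ k, 0 < M k) (h3 : ∀ k, 3 * M k ≤ M (k + 1))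
    (hη : ∀ k, η k ≤ 1) (K l : ℕ) :
    (η (l + K) : ℝ) / M (l + K) ≤ 1 / M K * (1 / 3) ^ l := by
  have h1 : (η (l + K) : ℝ) ≤ 1 := by exact_mod_cast hη _
  have h2 : (3 : ℝ) ^ l * M K ≤ M (l + K) := by
    rw [add_comm l K]
    exact_mod_cast three_pow_mul_le_of_lacunary h3 K l
  have h4 : (0 : ℝ) < M K := by exact_mod_cast hM K
  calc (η (l + K) : ℝ) / M (l + K) ≤ 1 / (3 ^ l * M K) := by gcongr
    _ = 1 / M K * (1 / 3) ^ l := by rw [one_div_pow]; field_simp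

lemma summable_digit_div (hM : ∀ k, 0 < M k) (h3 : ∀ k, 3 * M k ≤ M (k + 1))
    (hη : ∀ k, η k ≤ 1) : Summable fun k => (η k : ℝ) / M k :=
  Summable.of_nonneg_of_le (fun _ => by positivity)
    (digit_div_le_geometric hM h3 hη 0)
    ((summable_geometric_of_lt_one (by norm_num) (by norm_num)).mul_left _)

lemma tsum_digit_div_tail_le (hM : ∀ k, 0 < M k) (h3 : ∀ k, 3 * M k ≤ M (k + 1))
    (hη : ∀ k, η k ≤ 1) (K : ℕ) :
    ∑' l, (η (l + K) : ℝ) / M (l + K) ≤ 2 / M K := by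
  have hg : Summable fun l : ℕ => 1 / (M K : ℝ) * (1 / 3 : ℝ) ^ l :=
    (summable_geometric_of_lt_one (by norm_num) (by norm_num)).mul_left _
  calc ∑' l, (η (l + K) : ℝ) / M (l + K)
      ≤ ∑' l : ℕ, 1 / (M K : ℝ) * (1 / 3 : ℝ) ^ l :=
        Summable.tsum_le_tsum (digit_div_le_geometric hM h3 hη K)
          ((summable_nat_add_iff K).2 (summable_digit_div hM h3 hη)) hg
    _ = 1 / M K * (3 / 2) := by
        rw [tsum_mul_left, tsum_geometric_of_lt_one (by norm_num) (by norm_num)]; norm_num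
    _ ≤ 1 / M K * 2 := by gcongr; norm_num
    _ = 2 / M K := by ring

/-- If `N` is a multiple of the first `K` denominators, then only the tail of the series
contributes to the distance of `N * θ` to the integers. -/
lemma nint_mul_tsum_digit_div_le (hM : ∀ k, 0 < M k) (h3 : ∀ k, 3 * M k ≤ M (k + 1))
    (hη : ∀ k, η k ≤ 1) {N K : ℕ} (hN : ∀ l < K, M l ∣ N) :
    nint (N * ∑' k, (η k : ℝ) / M k) ≤ 2 * N / M K := by
  have hz : (N : ℝ) * ∑ l ∈ Finset.range K, (η l : ℝ) / M l =
      ((∑ l ∈ Finset.range K, η l * (N / M l) : ℕ) : ℤ) := by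
    rw [Int.cast_natCast, Nat.cast_sum, Finset.mul_sum]
    refine Finset.sum_congr rfl fun l hl => ?_
    rw [Nat.cast_mul, Nat.cast_div (hN l (Finset.mem_range.1 hl)) (Nat.cast_ne_zero.2 (hM l).ne')]
    ring
  refine (nint_le_abs_sub _ ((∑ l ∈ Finset.range K, η l * (N / M l) : ℕ) : ℤ)).trans ?_
  rw [← hz, ← (summable_digit_div hM h3 hη).sum_add_tsum_nat_add K, mul_add, add_sub_cancel_left,
    abs_of_nonneg (mul_nonneg (by positivity) (tsum_nonneg fun _ => by positivity))]
  calc (N : ℝ) * ∑' l, (η (l + K) : ℝ) / M (l + K) ≤ N * (2 / M K) := by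
        gcongr
        exact tsum_digit_div_tail_le hM h3 hη K
    _ = 2 * N / M K := by ring

end Lacunary

lemma cos_two_pi_mul_eq_cos_nint (x : ℝ) :
    Real.cos (2 * Real.pi * x) = Real.cos (2 * Real.pi * nint x) := by
  have h : Real.cos (2 * Real.pi * x) = Real.cos (2 * Real.pi * (x - round x)) := by
    rw [← Real.cos_sub_int_mul_two_pi _ (round x)]
    congr 1
    ring
  rw [h, ← Real.cos_abs (2 * Real.pi * (x - round x)), abs_mul, abs_of_pos Real.two_pi_pos]
  rfl

/-- The product `∏ (1 + 2 cos (2 π x_i)) / 3` converges to a positive limit when the distances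
`‖x_i‖` are at most `1 / 4` and square summable. -/
lemma exists_pos_tendsto_prod_cos {x : ℕ → ℝ} (hx : ∀ i, nint (x i) ≤ 1 / 4)
    (hs : Summable fun i => nint (x i) ^ 2) :
    ∃ L : ℝ, 0 < L ∧ Filter.Tendsto
      (fun n => ∏ i ∈ Finset.range n, (1 + 2 * Real.cos (2 * Real.pi * x i)) / 3)
      Filter.atTop (nhds L) := by
  set g : ℕ → ℝ := fun i => 2 / 3 * (Real.cos (2 * Real.pi * x i) - 1) with hg
  have hfac (i) : (1 + 2 * Real.cos (2 * Real.pi * x i)) / 3 = 1 + g i := by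
    simp only [hg]; ring
  have hpos (i) : 0 < 1 + g i := by
    have : 0 ≤ Real.cos (2 * Real.pi * x i) := by
      rw [cos_two_pi_mul_eq_cos_nint]
      have := mul_nonneg Real.pi_pos.le (nint_nonneg (x i))
      exact Real.cos_nonneg_of_neg_pi_div_two_le_of_le (by linarith [Real.pi_pos])
        (by nlinarith [Real.pi_pos, hx i])
    simp only [hg]; linarith
  have hgs : Summable g := by
    refine Summable.of_norm_bounded (hs.mul_left (2 / 3 * ((2 * Real.pi) ^ 2 / 2))) fun i => ?_
    have h1 := Real.one_sub_sq_div_two_le_cos (x := 2 * Real.pi * nint (x i))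
    rw [← cos_two_pi_mul_eq_cos_nint] at h1
    have h2 := Real.cos_le_one (2 * Real.pi * x i)
    rw [Real.norm_eq_abs, abs_of_nonpos (by simp only [hg]; linarith)]
    simp only [hg]
    nlinarith
  have hlog : Summable fun i => Real.log (1 + g i) := Real.summable_log_one_add_of_summable hgs
  refine ⟨Real.exp (∑' i, Real.log (1 + g i)), Real.exp_pos _, ?_⟩
  refine ((Real.continuous_exp.tendsto _).comp hlog.hasSum.tendsto_sum_nat).congr fun n => ?_
  simp only [Function.comp_apply, Real.exp_sum, Real.exp_log (hpos _), hfac]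

/-- For a subsequence `(m_{j_k})` with `j_1 > 1` and `m_j/m_{j-1} > 2^{k+2}`
for all `j ≥ j_k`, and any `η ∈ {0,1}^{ℕ*}`, the number `θ(η) = ∑_k η_k/m_{j_k}`
satisfies `‖m_j θ(η)‖ ≤ 2 m_j/m_{j_k}` (`k` smallest with `j_k > j`),
`∑_j ‖m_j θ(η)‖² < ∞` and `L(θ(η)) > 0`. -/
theorem stmt_13 (m : ℕ → ℕ) (hpos : ∀ j, 1 ≤ j → 0 < m j)
    (hmono : ∀ j, 1 ≤ j → m j < m (j + 1))
    (hratio : ∀ j, 1 ≤ j → 3 * m j ≤ m (j + 1))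
    (hdvd : ∀ j, 1 ≤ j → m j ∣ m (j + 1))
    (hlim : Filter.Tendsto (fun j : ℕ => (m (j + 1) : ℝ) / (m j : ℝ))
      Filter.atTop Filter.atTop)
    (jj : ℕ → ℕ) (hjj : ∀ k, 1 ≤ k → jj k < jj (k + 1)) (hj1 : 1 < jj 1)
    (hgap : ∀ k, 1 ≤ k → ∀ i, jj k ≤ i → 2 ^ (k + 2) * m (i - 1) < m i)
    (η : ℕ → ℕ) (hη : ∀ k, 1 ≤ k → η k ≤ 1)
    (θ : ℝ) (hθ : θ = ∑' k : ℕ, (η (k + 1) : ℝ) / (m (jj (k + 1)) : ℝ)) :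
    (∀ i, 1 ≤ i → ∀ k, 1 ≤ k → i < jj k → (∀ l, 1 ≤ l → l < k → jj l ≤ i) →
      nint ((m i : ℝ) * θ) ≤ 2 * (m i : ℝ) / (m (jj k) : ℝ)) ∧
    Summable (fun i : ℕ => nint ((m (i + 1) : ℝ) * θ) ^ 2) ∧
    ∃ L : ℝ, 0 < L ∧
      Filter.Tendsto (fun k : ℕ => ∏ j ∈ Finset.Icc 1 (k - 1),
          (1 + 2 * Real.cos (2 * Real.pi * (m j : ℝ) * θ)) / 3)
        Filter.atTop (nhds L) := by
  have hjj1 (k : ℕ) : k + 1 < jj (k + 1) := by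
    induction k with
    | zero => exact hj1
    | succ k ih => exact lt_of_le_of_lt ih (hjj (k + 1) (by omega))
  have hdvd' {i j : ℕ} (hi : 1 ≤ i) (hij : i ≤ j) : m i ∣ m j := by
    have := dvd_of_dvd_succ (u := fun i => m (i + 1)) (fun i => hdvd (i + 1) (by omega))
      (Nat.sub_le_sub_right hij 1)
    simpa only [Nat.sub_add_cancel hi, Nat.sub_add_cancel (hi.trans hij)] using this
  have hgrow {i : ℕ} (hi : 1 ≤ i) (n : ℕ) : 3 ^ n * m i ≤ m (i + n) := by
    have := three_pow_mul_le_of_lacunary (u := fun i => m (i + 1))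
      (fun i => hratio (i + 1) (by omega)) (i - 1) n
    simpa only [Nat.sub_add_cancel hi, show i - 1 + n + 1 = i + n by omega] using this
  have hM (k : ℕ) : 0 < m (jj (k + 1)) := hpos _ (by have := hjj1 k; omega)
  have hM3 (k : ℕ) : 3 * m (jj (k + 1)) ≤ m (jj (k + 1 + 1)) :=
    (hratio _ (by have := hjj1 k; omega)).trans
      (Nat.le_of_dvd (hM (k + 1)) (hdvd' (by omega) (hjj (k + 1) (by omega))))
  have hbound : ∀ i, 1 ≤ i → ∀ k, 1 ≤ k → i < jj k → (∀ l, 1 ≤ l → l < k → jj l ≤ i) →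
      nint ((m i : ℝ) * θ) ≤ 2 * (m i : ℝ) / (m (jj k) : ℝ) := by
    intro i _ k hk _ hl
    obtain ⟨K, rfl⟩ := Nat.exists_eq_add_of_le' hk
    rw [hθ]
    exact nint_mul_tsum_digit_div_le (M := fun k => m (jj (k + 1))) (η := fun k => η (k + 1))
      hM hM3 (fun k => hη _ (by omega))
      (K := K) fun l hlK => hdvd' (by have := hjj1 l; omega) (hl (l + 1) (by omega) (by omega))
  have hblock (i : ℕ) : ∃ K n, i + 1 + n + 1 = jj (K + 1) ∧ ∀ l < K, jj (l + 1) ≤ i + 1 := by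
    have hex : ∃ K, i + 1 < jj (K + 1) := ⟨i, hjj1 i⟩
    classical
    obtain ⟨n, hn⟩ := Nat.exists_eq_add_of_lt (Nat.find_spec hex)
    exact ⟨Nat.find hex, n, hn.symm, fun l hl => not_lt.1 (Nat.find_min hex hl)⟩
  choose K n hKn hKmin using hblock
  have hdecay (i : ℕ) :
      nint ((m (i + 1) : ℝ) * θ) ≤ 1 / 4 * ((1 / 2) ^ K i * (1 / 3) ^ n i) := by
    have h1 := hbound (i + 1) (by omega) (K i + 1) (by omega) (by have := hKn i; omega) (by
      intro l hl hlK
      obtain ⟨l, rfl⟩ := Nat.exists_eq_add_of_le' hl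
      exact hKmin i l (by omega))
    have h2 := hgap (K i + 1) (by omega) _ le_rfl
    have h3 := hgrow (show 1 ≤ i + 1 by omega) (n i)
    rw [show jj (K i + 1) - 1 = i + 1 + n i by have := hKn i; omega] at h2
    have h4 : (2 : ℝ) ^ (K i + 1 + 2) * (3 ^ n i * m (i + 1)) ≤ m (jj (K i + 1)) := by
      exact_mod_cast (Nat.mul_le_mul_left _ h3).trans h2.le
    have h5 : (0 : ℝ) < m (i + 1) := by exact_mod_cast hpos (i + 1) (by omega)
    calc nint ((m (i + 1) : ℝ) * θ) ≤ 2 * m (i + 1) / m (jj (K i + 1)) := h1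
      _ ≤ 2 * m (i + 1) / (2 ^ (K i + 1 + 2) * (3 ^ n i * m (i + 1))) := by gcongr
      _ = 1 / 4 * ((1 / 2) ^ K i * (1 / 3) ^ n i) := by
        simp only [pow_add, one_div, inv_pow]; field_simp; norm_num
  have hquarter (i : ℕ) : nint ((m (i + 1) : ℝ) * θ) ≤ 1 / 4 := by
    have h1 : (1 / 2 : ℝ) ^ K i ≤ 1 := pow_le_one₀ (by norm_num) (by norm_num)
    have h2 : (1 / 3 : ℝ) ^ n i ≤ 1 := pow_le_one₀ (by norm_num) (by norm_num)
    have h3 := mul_le_one₀ h1 (by positivity) h2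
    linarith [hdecay i]
  have hinj : Function.Injective fun i => (K i, n i) := by
    intro a b hab
    obtain ⟨hK, hn⟩ := Prod.mk.inj hab
    have ha := hKn a
    rw [hK, hn, ← hKn b] at ha
    omega
  have hsum : Summable fun i => nint ((m (i + 1) : ℝ) * θ) := by
    have hgeo := (summable_geometric_of_lt_one (r := (1 / 2 : ℝ)) (by norm_num) (by norm_num)
      ).mul_of_nonneg (summable_geometric_of_lt_one (r := (1 / 3 : ℝ)) (by norm_num) (by norm_num))
      (fun _ => by positivity) (fun _ => by positivity)
    exact Summable.of_nonneg_of_le (fun _ => nint_nonneg _) hdecay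
      ((hgeo.comp_injective hinj).mul_left (1 / 4))
  have hsq : Summable fun i => nint ((m (i + 1) : ℝ) * θ) ^ 2 :=
    Summable.of_nonneg_of_le (fun _ => sq_nonneg _)
      (fun i => pow_le_of_le_one (nint_nonneg _) ((hquarter i).trans (by norm_num)) two_ne_zero) hsum
  refine ⟨hbound, hsq, ?_⟩
  obtain ⟨L, hL, hlimit⟩ := exists_pos_tendsto_prod_cos hquarter hsq
  refine ⟨L, hL, (hlimit.comp (Filter.tendsto_sub_atTop_nat 1)).congr fun k => ?_⟩
  rw [Function.comp_apply, Finset.range_eq_Ico, ← Finset.Ico_add_one_right_eq_Icc]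
  simpa only [zero_add, mul_assoc] using Finset.prod_Ico_add'
    (fun j => (1 + 2 * Real.cos (2 * Real.pi * (m j : ℝ) * θ)) / 3) 0 (k - 1) 1
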